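/- arXiv:2109.10216 — 2 statements merged into one kernel-verified Lean document; each statement's English description precedes it below -/
import Mathlib

section
/- Let a, b, c be linearly independent unit vectors in ℝ³ satisfying |⟪a,c⟫| = |⟪b,c⟫| < |⟪a,b⟫| ≤ 1/2 (i.e. the angles between the corresponding lines satisfy 60° ≤ φ_AB < φ_AC = φ_BC). Then the set of minimizers of J over the unit sphere is exactly {a, -a, b, -b}. -/
open RealInnerProductSpace

noncomputable def dS (x y : EuclideanSpace ℝ (Fin 3)) : ℝ := Real.sqrt (1 - ⟪x, y⟫ ^ 2)

noncomputable def J (a b c p : EuclideanSpace ℝ (Fin 3)) : ℝ := dS a p + dS b p + dS c p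

def IsMinimizer (a b c p : EuclideanSpace ℝ (Fin 3)) : Prop :=
  ‖p‖ = 1 ∧ ∀ q : EuclideanSpace ℝ (Fin 3), ‖q‖ = 1 → J a b c p ≤ J a b c q

lemma symm_bound (g m σ ζ : ℝ) (hg : 1 / 8 ≤ g) (hm0 : 0 < m) (hm : m ≤ 1 / 2)
    (hσ : 0 ≤ σ) (hζ : 0 ≤ ζ) (hζ2 : ζ ^ 2 ≤ 2)
    (h : 2 * (1 - σ ^ 2 / 4) ^ 2 + 4 * m * (1 - σ ^ 2 / 4) * (1 - ζ ^ 2) + 2 * m ^ 2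
      ≤ (1 - g) * (1 - (1 - ζ ^ 2) ^ 2)) :
    2 * √(1 + m) ≤ σ + ζ := by
  by_contra! hcon
  set μ := √(1 + m) with hμ
  have hμ2 : μ ^ 2 = 1 + m := Real.sq_sqrt (by linarith)
  have hμ0 : 0 ≤ μ := Real.sqrt_nonneg _
  have hL : 0 ≤ μ - ζ * (m + 1 / 4) := by
    have : ζ * (m + 1 / 4) ≤ μ := by
      apply abs_le_of_sq_le_sq' _ hμ0 |>.2
      rw [hμ2, mul_pow]
      nlinarith [mul_nonneg (sub_nonneg.2 hζ2) (sq_nonneg (m + 1 / 4))]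
    linarith
  set X := 1 - σ ^ 2 / 4 with hX
  have hX0 : 1 - (μ - ζ / 2) ^ 2 < X := by
    rw [hX]
    nlinarith
  have hXZ : ζ * (μ - ζ * (m + 1 / 4)) < X + m * (1 - ζ ^ 2) := by nlinarith
  have h0 : 0 ≤ ζ * (μ - ζ * (m + 1 / 4)) := mul_nonneg hζ hL
  have hsq : (ζ * (μ - ζ * (m + 1 / 4))) ^ 2 < (X + m * (1 - ζ ^ 2)) ^ 2 := by
    apply pow_lt_pow_left₀ hXZ h0 (by norm_num)
  have hid : 2 * (μ - ζ * (m + 1 / 4)) ^ 2 - (7 / 8 - 2 * m ^ 2) * (2 - ζ ^ 2)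
      = (μ * ζ - 2 * (m + 1 / 4)) ^ 2 := by
    linear_combination (2 - ζ ^ 2) * hμ2
  have h5 : 2 * (X + m * (1 - ζ ^ 2)) ^ 2 ≤ (1 - g - 2 * m ^ 2) * (ζ ^ 2 * (2 - ζ ^ 2)) := by
    nlinarith
  have h6 : 0 ≤ ζ ^ 2 * (2 - ζ ^ 2) := mul_nonneg (sq_nonneg _) (by linarith)
  have h7 : 0 ≤ ζ ^ 2 * (μ * ζ - 2 * (m + 1 / 4)) ^ 2 := by positivity
  rw [← hid] at h7
  nlinarith [mul_nonneg (sub_nonneg.2 hg) h6]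

lemma sqrt_conc (u v t : ℝ) (hu : 0 ≤ u) (hv : 0 ≤ v) (ht : 0 ≤ t) (ht1 : t ≤ 1) :
    (1 - t) * √u + t * √v ≤ √((1 - t) * u + t * v) := by
  apply Real.le_sqrt_of_sq_le
  have h1 := Real.sq_sqrt hu
  have h2 := Real.sq_sqrt hv
  have : 0 ≤ t * (1 - t) * (√u - √v) ^ 2 :=
    mul_nonneg (mul_nonneg ht (by linarith)) (sq_nonneg _)
  have e : (1 - t) * u + t * v - ((1 - t) * √u + t * √v) ^ 2 = t * (1 - t) * (√u - √v) ^ 2 := by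
    linear_combination -(1 - t) * h1 - t * h2
  linarith

set_option maxHeartbeats 1000000 in
lemma core_bound (g m ξ η ζ : ℝ) (hg : 1 / 8 ≤ g) (hgm : g < m) (hm : m ≤ 1 / 2)
    (hξ : 0 ≤ ξ) (hη : 0 ≤ η) (hζ : 0 ≤ ζ)
    (hQ : (η ^ 2 - ξ ^ 2) ^ 2 / (2 * (1 + g))
      + (2 - ξ ^ 2 - η ^ 2 + 2 * m * (1 - ζ ^ 2)) ^ 2 / (2 - 2 * g - 4 * m ^ 2)
      + (1 - ζ ^ 2) ^ 2 ≤ 1)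
    (htri : √(1 + g) ≤ ξ + η) :
    √(1 + g) + √(1 + m) ≤ ξ + η + ζ ∧
      (ξ + η + ζ ≤ √(1 + g) + √(1 + m) → ξ * η = 0) := by
  have hlt : √(1 + g) < √(1 + m) := Real.sqrt_lt_sqrt (by linarith) (by linarith)
  have hm0 : 0 < m := by linarith
  have hD : 0 < 2 - 2 * g - 4 * m ^ 2 := by nlinarith
  have hg1 : 0 < 1 + g := by linarith
  obtain ⟨s, hs⟩ : ∃ s, (ξ + η) ^ 2 = (1 + g) * s := ⟨(ξ + η) ^ 2 / (1 + g), by field_simp⟩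
  have hs1 : 1 ≤ s := by
    have := pow_le_pow_left₀ (Real.sqrt_nonneg _) htri 2
    rw [Real.sq_sqrt hg1.le, hs] at this
    nlinarith
  have hσ : ξ + η = √((1 + g) * s) := by
    rw [← hs, Real.sqrt_sq (by linarith)]
  have hA : (2 - ξ ^ 2 - η ^ 2 + 2 * m * (1 - ζ ^ 2) - (2 - 2 * g - 4 * m ^ 2) * s / 2) ^ 2
      / (2 - 2 * g - 4 * m ^ 2) + ((1 - ζ ^ 2) + m * s) ^ 2 ≤ (s - 1) ^ 2 := by
    have e1 : (η ^ 2 - ξ ^ 2) ^ 2 / (2 * (1 + g))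
        = s * (4 - (1 + g) * s - 2 * (2 - ξ ^ 2 - η ^ 2)) / 2 := by
      have : (η ^ 2 - ξ ^ 2) ^ 2
          = (ξ + η) ^ 2 * (4 - (ξ + η) ^ 2 - 2 * (2 - ξ ^ 2 - η ^ 2)) := by ring
      rw [this, hs]
      field_simp
    rw [e1] at hQ
    have e2 : (2 - ξ ^ 2 - η ^ 2 + 2 * m * (1 - ζ ^ 2) - (2 - 2 * g - 4 * m ^ 2) * s / 2) ^ 2
        / (2 - 2 * g - 4 * m ^ 2) = (2 - ξ ^ 2 - η ^ 2 + 2 * m * (1 - ζ ^ 2)) ^ 2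
        / (2 - 2 * g - 4 * m ^ 2) - (2 - ξ ^ 2 - η ^ 2 + 2 * m * (1 - ζ ^ 2)) * s
        + (2 - 2 * g - 4 * m ^ 2) * s ^ 2 / 4 := by
      have := hD.ne'
      generalize 2 - 2 * g - 4 * m ^ 2 = D at *
      field_simp
      ring
    rw [e2]
    linarith
  set D := 2 - 2 * g - 4 * m ^ 2 with hDdef
  have hZ1 : (1 - ζ ^ 2) ^ 2 ≤ 1 := by
    have : 0 ≤ (η ^ 2 - ξ ^ 2) ^ 2 / (2 * (1 + g)) := by positivity
    have : 0 ≤ (2 - ξ ^ 2 - η ^ 2 + 2 * m * (1 - ζ ^ 2)) ^ 2 / D := by positivity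
    linarith
  have hζ2 : ζ ^ 2 ≤ 2 := by nlinarith
  have hZs : (1 - ζ ^ 2) + m * s ≤ s - 1 := by
    apply abs_le_of_sq_le_sq' _ (by linarith) |>.2
    have : 0 ≤ (2 - ξ ^ 2 - η ^ 2 + 2 * m * (1 - ζ ^ 2) - D * s / 2) ^ 2 / D := by positivity
    linarith
  rcases le_or_gt (2 - (1 + g) * s / 2 + 2 * m * (1 - ζ ^ 2)) (D * s / 2) with hcase | hcase
  · -- comparison with the symmetric plane
    have key : 2 * √(1 + m) ≤ (ξ + η) + ζ := by
      apply symm_bound g m (ξ + η) ζ hg hm0 hm (by linarith) hζ hζ2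
      rw [hs]
      have hle : (2 - (1 + g) * s / 2 + 2 * m * (1 - ζ ^ 2) - D * s / 2) ^ 2 / D
          ≤ (2 - ξ ^ 2 - η ^ 2 + 2 * m * (1 - ζ ^ 2) - D * s / 2) ^ 2 / D := by
        apply div_le_div_of_nonneg_right _ hD.le
        have : 2 - ξ ^ 2 - η ^ 2 ≤ 2 - (1 + g) * s / 2 := by nlinarith [sq_nonneg (ξ - η)]
        apply sq_le_sq.2
        rw [abs_of_nonpos (by linarith), abs_of_nonpos (by linarith)]
        linarith
      have h3 := hle.trans (le_sub_right_of_add_le hA)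
      rw [div_le_iff₀ hD] at h3
      rw [hDdef] at h3
      linarith
    constructor
    · linarith
    · intro h
      linarith
  · have hden : 0 < 3 - g - 4 * m := by linarith
    have hss : s * (3 - g - 4 * m) < 4 - 4 * m := by
      rw [hDdef] at hcase
      have := mul_le_mul_of_nonneg_left hZs hm0.le
      linarith
    obtain ⟨s1, hs1def⟩ : ∃ s1, s1 = 4 * (1 - m) / (3 - g - 4 * m) := ⟨_, rfl⟩
    have hs1e : s1 * (3 - g - 4 * m) = 4 * (1 - m) := by rw [hs1def]; field_simp
    have hss1 : s < s1 := by
      rw [hs1def, lt_div_iff₀ hden]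
      linarith
    have hnn : 0 ≤ 2 - (1 - m) * s1 := by
      have : (2 - (1 - m) * s1) * (3 - g - 4 * m) = D := by
        rw [hDdef]; linear_combination -(1 - m) * hs1e
      exact nonneg_of_mul_nonneg_left (this ▸ hD.le) hden
    have hs10 : 0 < s1 := by linarith
    have hend : 2 * √(1 + m) ≤ √((1 + g) * s1) + √(2 - (1 - m) * s1) := by
      apply symm_bound g m _ _ hg hm0 hm (Real.sqrt_nonneg _) (Real.sqrt_nonneg _)
      · rw [Real.sq_sqrt hnn]
        have : 0 ≤ (1 - m) * s1 := mul_nonneg (by linarith) hs10.le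
        linarith
      · rw [Real.sq_sqrt hnn, Real.sq_sqrt (by positivity), hs1def]
        apply le_of_eq
        field_simp
        ring
    obtain ⟨t, ht⟩ : ∃ t, t = (s - 1) / (s1 - 1) := ⟨_, rfl⟩
    have h11 : 0 < s1 - 1 := by linarith
    have hts : s = (1 - t) * 1 + t * s1 := by
      rw [ht]; field_simp; ring
    have ht0 : 0 ≤ t := by rw [ht]; exact div_nonneg (by linarith) h11.le
    have ht1 : t ≤ 1 := by rw [ht, div_le_one h11]; linarith
    have c1 := sqrt_conc (1 + g) ((1 + g) * s1) t hg1.le (by positivity) ht0 ht1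
    have c2 := sqrt_conc (1 + m) (2 - (1 - m) * s1) t (by linarith) hnn ht0 ht1
    have e1 : (1 - t) * (1 + g) + t * ((1 + g) * s1) = (1 + g) * s := by rw [hts]; ring
    have e2 : (1 - t) * (1 + m) + t * (2 - (1 - m) * s1) = 2 - (1 - m) * s := by rw [hts]; ring
    rw [e1, ← hσ] at c1
    rw [e2] at c2
    have c3 : √(2 - (1 - m) * s) ≤ ζ := by
      apply Real.sqrt_le_iff.2 ⟨hζ, by linarith⟩
    have hf : √(1 + g) + √(1 + m) + t * (√(1 + m) - √(1 + g)) ≤ ξ + η + ζ := by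
      have := mul_le_mul_of_nonneg_left hend ht0
      linarith
    have hpos : 0 ≤ t * (√(1 + m) - √(1 + g)) := mul_nonneg ht0 (by linarith)
    refine ⟨by linarith, fun h => ?_⟩
    have htz : t = 0 := by
      have : t * (√(1 + m) - √(1 + g)) = 0 := by linarith
      rcases mul_eq_zero.1 this with h | h
      · exact h
      · linarith
    have hs_one : s = 1 := by rw [hts, htz]; ring
    rw [hs_one] at hA hs
    have q1 : 0 ≤ (2 - ξ ^ 2 - η ^ 2 + 2 * m * (1 - ζ ^ 2) - D * 1 / 2) ^ 2 / D := by positivity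
    have q2 : (1 - ζ ^ 2 + m * 1) ^ 2 = 0 := by
      have q0 := sq_nonneg (1 - ζ ^ 2 + m * 1)
      refine le_antisymm ?_ q0
      linarith
    have q3 : (2 - ξ ^ 2 - η ^ 2 + 2 * m * (1 - ζ ^ 2) - D * 1 / 2) ^ 2 / D = 0 := by
      rw [q2] at hA
      refine le_antisymm ?_ q1
      linarith
    have q4 : 1 - ζ ^ 2 + m * 1 = 0 := by simpa using q2
    have q5 : 2 - ξ ^ 2 - η ^ 2 + 2 * m * (1 - ζ ^ 2) - D * 1 / 2 = 0 := by
      rcases div_eq_zero_iff.1 q3 with h | h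
      · simpa using h
      · linarith
    have q6 : 1 - ζ ^ 2 = -m := by linarith
    rw [q6, hDdef] at q5
    linarith

lemma inner3 (x y : EuclideanSpace ℝ (Fin 3)) :
    ⟪x, y⟫ = x 0 * y 0 + x 1 * y 1 + x 2 * y 2 := by
  simp [PiLp.inner_apply, Fin.sum_univ_three, mul_comm]

lemma psd (a b c p : EuclideanSpace ℝ (Fin 3)) (α β ν : ℝ)
    (ha : ⟪a, a⟫ = 1) (hb : ⟪b, b⟫ = 1) (hc : ⟪c, c⟫ = 1) (hp : ⟪p, p⟫ = 1) :
    0 ≤ 3 * (1 + α ^ 2 + β ^ 2 + ν ^ 2 + 2 * α * ⟪a, p⟫ ^ 2 + 2 * β * ⟪b, p⟫ ^ 2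
      + 2 * ν * ⟪c, p⟫ ^ 2 + 2 * α * β * ⟪a, b⟫ ^ 2 + 2 * α * ν * ⟪a, c⟫ ^ 2
      + 2 * β * ν * ⟪b, c⟫ ^ 2) - (1 + α + β + ν) ^ 2 := by
  have key : 0 ≤ 3 * (⟪p, p⟫ ^ 2 + α ^ 2 * ⟪a, a⟫ ^ 2 + β ^ 2 * ⟪b, b⟫ ^ 2 + ν ^ 2 * ⟪c, c⟫ ^ 2
      + 2 * α * ⟪a, p⟫ ^ 2 + 2 * β * ⟪b, p⟫ ^ 2
      + 2 * ν * ⟪c, p⟫ ^ 2 + 2 * α * β * ⟪a, b⟫ ^ 2 + 2 * α * ν * ⟪a, c⟫ ^ 2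
      + 2 * β * ν * ⟪b, c⟫ ^ 2) - (⟪p, p⟫ + α * ⟪a, a⟫ + β * ⟪b, b⟫ + ν * ⟪c, c⟫) ^ 2 := by
    simp only [inner3]
    let T : Fin 3 → Fin 3 → ℝ := fun i j =>
      p i * p j + α * (a i * a j) + β * (b i * b j) + ν * (c i * c j)
    have : 0 ≤ 6 * ((T 0 1) ^ 2 + (T 0 2) ^ 2 + (T 1 2) ^ 2) + (T 0 0 - T 1 1) ^ 2
      + (T 0 0 - T 2 2) ^ 2 + (T 1 1 - T 2 2) ^ 2 := by positivity
    refine this.trans_eq ?_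
    simp only [T]
    ring
  rw [ha, hb, hc, hp] at key
  linarith

lemma dS_nonneg (x y : EuclideanSpace ℝ (Fin 3)) : 0 ≤ dS x y := Real.sqrt_nonneg _

lemma inner_sq_le (x y : EuclideanSpace ℝ (Fin 3)) (hx : ‖x‖ = 1) (hy : ‖y‖ = 1) :
    ⟪x, y⟫ ^ 2 ≤ 1 := by
  have := abs_real_inner_le_norm x y
  rw [hx, hy, mul_one] at this
  exact (sq_le_one_iff_abs_le_one _).2 this

lemma dS_sq (x y : EuclideanSpace ℝ (Fin 3)) (hx : ‖x‖ = 1) (hy : ‖y‖ = 1) :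
    dS x y ^ 2 = 1 - ⟪x, y⟫ ^ 2 :=
  Real.sq_sqrt (by linarith [inner_sq_le x y hx hy])

lemma dS_eq (x y : EuclideanSpace ℝ (Fin 3)) (hx : ‖x‖ = 1) (hy : ‖y‖ = 1) :
    dS x y = ‖x - ⟪x, y⟫ • y‖ := by
  rw [dS, ← Real.sqrt_sq (norm_nonneg (x - ⟪x, y⟫ • y))]
  congr 1
  rw [norm_sub_sq_real, norm_smul, inner_smul_right, mul_pow, hx, hy, Real.norm_eq_abs, sq_abs]
  ring

lemma dS_tri (a b p : EuclideanSpace ℝ (Fin 3)) (ha : ‖a‖ = 1) (hb : ‖b‖ = 1) (hp : ‖p‖ = 1) :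
    dS a b ≤ dS a p + dS b p := by
  have h1 : dS a b ≤ ‖a - (⟪a, p⟫ * ⟪b, p⟫) • b‖ := by
    apply Real.sqrt_le_iff.2 ⟨norm_nonneg _, ?_⟩
    rw [norm_sub_sq_real, norm_smul, inner_smul_right, mul_pow, ha, hb, Real.norm_eq_abs, sq_abs]
    nlinarith [sq_nonneg (⟪a, b⟫ - ⟪a, p⟫ * ⟪b, p⟫)]
  have h2 : a - (⟪a, p⟫ * ⟪b, p⟫) • b = (a - ⟪a, p⟫ • p) + ⟪a, p⟫ • (p - ⟪p, b⟫ • b) := by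
    rw [real_inner_comm b p, smul_sub, smul_smul]
    abel
  have h3 : ‖⟪a, p⟫ • (p - ⟪p, b⟫ • b)‖ ≤ dS b p := by
    rw [norm_smul, ← dS_eq p b hp hb, Real.norm_eq_abs]
    have e : dS p b = dS b p := by rw [dS, dS, real_inner_comm]
    rw [e]
    have := (sq_le_one_iff_abs_le_one _).1 (inner_sq_le a p ha hp)
    nlinarith [dS_nonneg b p]
  calc dS a b ≤ _ := h1
    _ ≤ ‖a - ⟪a, p⟫ • p‖ + ‖⟪a, p⟫ • (p - ⟪p, b⟫ • b)‖ := by rw [h2]; exact norm_add_le _ _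
    _ ≤ _ := by rw [← dS_eq a p ha hp]; linarith

lemma dS_zero (a p : EuclideanSpace ℝ (Fin 3)) (ha : ‖a‖ = 1) (hp : ‖p‖ = 1)
    (h : dS a p = 0) : p = a ∨ p = -a := by
  have h2 := dS_sq a p ha hp
  rw [h] at h2
  have h3 : ⟪a, p⟫ = 1 ∨ ⟪a, p⟫ = -1 := by
    have h5 : (⟪a, p⟫ - 1) * (⟪a, p⟫ + 1) = 0 := by linarith
    rcases mul_eq_zero.1 h5 with h5 | h5
    · left; linarith
    · right; linarith
  rw [dS_eq a p ha hp, norm_eq_zero, sub_eq_zero] at h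
  rcases h3 with h3 | h3
  · left; rw [h, h3, one_smul]
  · right; rw [h3] at h; rw [h]; simp

lemma main_bound (a b c p : EuclideanSpace ℝ (Fin 3))
    (ha : ‖a‖ = 1) (hb : ‖b‖ = 1) (hc : ‖c‖ = 1) (hp : ‖p‖ = 1)
    (h1 : |⟪a, c⟫| = |⟪b, c⟫|) (h2 : |⟪b, c⟫| < |⟪a, b⟫|) (h3 : |⟪a, b⟫| ≤ 1 / 2) :
    dS a b + dS a c ≤ J a b c p ∧
      (J a b c p ≤ dS a b + dS a c → dS a p * dS b p = 0) := by
  have h1' : ⟪a, c⟫ ^ 2 = ⟪b, c⟫ ^ 2 := (sq_eq_sq_iff_abs_eq_abs _ _).2 h1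
  have h2' : ⟪b, c⟫ ^ 2 < ⟪a, b⟫ ^ 2 := sq_lt_sq.2 h2
  have h3' : ⟪a, b⟫ ^ 2 ≤ 1 / 4 := by
    have := sq_le_sq.2 (h3.trans (le_abs_self _)); linarith
  obtain ⟨r, hr0, hr⟩ : ∃ r : ℝ, 0 < r ∧ r ^ 2 = 3 / 2 :=
    ⟨√(3 / 2), by positivity, Real.sq_sqrt (by norm_num)⟩
  obtain ⟨g, hgd⟩ : ∃ g, g = (1 - 3 * ⟪a, b⟫ ^ 2) / 2 := ⟨_, rfl⟩
  obtain ⟨m, hmd⟩ : ∃ m, m = (1 - 3 * ⟪a, c⟫ ^ 2) / 2 := ⟨_, rfl⟩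
  have hg : 1 / 8 ≤ g := by linarith
  have hgm : g < m := by linarith
  have hm : m ≤ 1 / 2 := by nlinarith [sq_nonneg ⟪a, c⟫]
  have eab : √(1 + g) = r * dS a b := by
    rw [← Real.sqrt_sq (mul_nonneg hr0.le (dS_nonneg a b)), mul_pow, dS_sq a b ha hb, hr, hgd]
    congr 1; ring
  have eac : √(1 + m) = r * dS a c := by
    rw [← Real.sqrt_sq (mul_nonneg hr0.le (dS_nonneg a c)), mul_pow, dS_sq a c ha hc, hr, hmd]
    congr 1; ring
  have hD : 0 < 2 - 2 * g - 4 * m ^ 2 := by nlinarith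
  have hg1 : 0 < 2 * (1 + g) := by linarith
  have key := core_bound g m (r * dS a p) (r * dS b p) (r * dS c p) hg hgm hm
    (mul_nonneg hr0.le (dS_nonneg a p)) (mul_nonneg hr0.le (dS_nonneg b p))
    (mul_nonneg hr0.le (dS_nonneg c p)) ?_ ?_
  · rw [eab, eac] at key
    obtain ⟨k1, k2⟩ := key
    unfold J
    constructor
    · by_contra! hh
      nlinarith
    · intro hh
      have := k2 (by nlinarith)
      have e : r ^ 2 * (dS a p * dS b p) = 0 := by linarith
      rw [hr] at e
      linarith
  · rw [mul_pow, mul_pow, mul_pow, dS_sq a p ha hp, dS_sq b p hb hp, dS_sq c p hc hp, hr]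
    obtain ⟨X, hX⟩ : ∃ X, X = (3 * ⟪a, p⟫ ^ 2 - 1) / 2 := ⟨_, rfl⟩
    obtain ⟨Y, hY⟩ : ∃ Y, Y = (3 * ⟪b, p⟫ ^ 2 - 1) / 2 := ⟨_, rfl⟩
    obtain ⟨Z, hZ⟩ : ∃ Z, Z = (3 * ⟪c, p⟫ ^ 2 - 1) / 2 := ⟨_, rfl⟩
    have hpsd : ∀ α β ν : ℝ, 0 ≤ 1 + α ^ 2 + β ^ 2 + ν ^ 2 + 2 * α * X + 2 * β * Y + 2 * ν * Z
        - 2 * α * β * g - 2 * α * ν * m - 2 * β * ν * m := by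
      intro α β ν
      have := psd a b c p α β ν (by simp [ha]) (by simp [hb])
        (by simp [hc]) (by simp [hp])
      have hmd' : m = (1 - 3 * ⟪b, c⟫ ^ 2) / 2 := by rw [hmd, h1']
      have e : (3 * (1 + α ^ 2 + β ^ 2 + ν ^ 2 + 2 * α * ⟪a, p⟫ ^ 2 + 2 * β * ⟪b, p⟫ ^ 2
        + 2 * ν * ⟪c, p⟫ ^ 2 + 2 * α * β * ⟪a, b⟫ ^ 2 + 2 * α * ν * ⟪a, c⟫ ^ 2
        + 2 * β * ν * ⟪b, c⟫ ^ 2) - (1 + α + β + ν) ^ 2) / 2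
        = 1 + α ^ 2 + β ^ 2 + ν ^ 2 + 2 * α * X + 2 * β * Y + 2 * ν * Z
        - 2 * α * β * g - 2 * α * ν * m - 2 * β * ν * m := by
        linear_combination -2 * α * hX - 2 * β * hY - 2 * ν * hZ + 2 * α * β * hgd
          + 2 * α * ν * hmd + 2 * β * ν * hmd'
      linarith
    have eX : 3 / 2 * (1 - ⟪a, p⟫ ^ 2) = 1 - X := by linarith
    have eY : 3 / 2 * (1 - ⟪b, p⟫ ^ 2) = 1 - Y := by linarith
    have eZ : 3 / 2 * (1 - ⟪c, p⟫ ^ 2) = 1 - Z := by linarith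
    rw [eX, eY, eZ]
    obtain ⟨w, hw⟩ : ∃ w, w * (2 - 2 * g - 4 * m ^ 2) = X + Y + 2 * m * Z :=
      ⟨(X + Y + 2 * m * Z) / (2 - 2 * g - 4 * m ^ 2), div_mul_cancel₀ _ hD.ne'⟩
    obtain ⟨v, hv⟩ : ∃ v, v * (2 * (1 + g)) = X - Y :=
      ⟨(X - Y) / (2 * (1 + g)), by field_simp⟩
    have h := hpsd (-w - v) (-w + v) (-Z - 2 * m * w)
    have f1 : (1 - Y - (1 - X)) ^ 2 / (2 * (1 + g)) = v ^ 2 * (2 * (1 + g)) := by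
      have : 1 - Y - (1 - X) = v * (2 * (1 + g)) := by rw [hv]; ring
      rw [this, div_eq_iff hg1.ne']; ring
    have f2 : (2 - (1 - X) - (1 - Y) + 2 * m * (1 - (1 - Z))) ^ 2 / (2 - 2 * g - 4 * m ^ 2)
        = w ^ 2 * (2 - 2 * g - 4 * m ^ 2) := by
      have : 2 - (1 - X) - (1 - Y) + 2 * m * (1 - (1 - Z)) = w * (2 - 2 * g - 4 * m ^ 2) := by
        rw [hw]; ring
      rw [this, div_eq_iff hD.ne']; ring
    rw [f1, f2]
    have e : 1 - (v ^ 2 * (2 * (1 + g)) + w ^ 2 * (2 - 2 * g - 4 * m ^ 2) + (1 - (1 - Z)) ^ 2)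
        = 1 + (-w - v) ^ 2 + (-w + v) ^ 2 + (-Z - 2 * m * w) ^ 2 + 2 * (-w - v) * X
        + 2 * (-w + v) * Y + 2 * (-Z - 2 * m * w) * Z - 2 * (-w - v) * (-w + v) * g
        - 2 * (-w - v) * (-Z - 2 * m * w) * m - 2 * (-w + v) * (-Z - 2 * m * w) * m := by
      linear_combination -2 * w * hw - 2 * v * hv
    linarith
  · rw [eab]
    nlinarith [dS_tri a b p ha hb hp]

theorem stmt1 (a b c : EuclideanSpace ℝ (Fin 3))
    (ha : ‖a‖ = 1) (hb : ‖b‖ = 1) (hc : ‖c‖ = 1)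
    (hli : LinearIndependent ℝ ![a, b, c])
    (h1 : |⟪a, c⟫| = |⟪b, c⟫|) (h2 : |⟪b, c⟫| < |⟪a, b⟫|) (h3 : |⟪a, b⟫| ≤ 1 / 2) :
    {p : EuclideanSpace ℝ (Fin 3) | IsMinimizer a b c p} = {a, -a, b, -b} := by
  have hself : ∀ x : EuclideanSpace ℝ (Fin 3), ‖x‖ = 1 → dS x x = 0 := by
    intro x hx
    simp [dS, hx]
  have hneg : ∀ x y : EuclideanSpace ℝ (Fin 3), dS x (-y) = dS x y := by
    intro x y
    simp [dS, inner_neg_right]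
  have hcomm : ∀ x y : EuclideanSpace ℝ (Fin 3), dS x y = dS y x := by
    intro x y
    rw [dS, dS, real_inner_comm]
  have hacbc : dS a c = dS b c := by
    rw [dS, dS, (sq_eq_sq_iff_abs_eq_abs _ _).2 h1]
  have hJa : J a b c a = dS a b + dS a c := by
    rw [J, hself a ha, hcomm b a, hcomm c a]; ring
  have hJb : J a b c b = dS a b + dS a c := by
    rw [J, hself b hb, hcomm c b, hacbc]; ring
  have hJn : ∀ x, J a b c (-x) = J a b c x := by
    intro x; simp [J, hneg]
  have hmin : ∀ p : EuclideanSpace ℝ (Fin 3), ‖p‖ = 1 → J a b c p = dS a b + dS a c →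
      IsMinimizer a b c p := by
    intro p hp he
    refine ⟨hp, fun q hq => ?_⟩
    rw [he]
    exact (main_bound a b c q ha hb hc hq h1 h2 h3).1
  ext p
  simp only [Set.mem_ofPred_eq, Set.mem_insert_iff, Set.mem_singleton_iff]
  constructor
  · rintro ⟨hp, hq⟩
    have h := hq a ha
    rw [hJa] at h
    rcases mul_eq_zero.1 ((main_bound a b c p ha hb hc hp h1 h2 h3).2 h) with h0 | h0
    · rcases dS_zero a p ha hp h0 with h | h <;> simp [h]
    · rcases dS_zero b p hb hp h0 with h | h <;> simp [h]
  · rintro (rfl | rfl | rfl | rfl)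
    · exact hmin _ ha hJa
    · exact hmin _ (by rw [norm_neg, ha]) (by rw [hJn, hJa])
    · exact hmin _ hb hJb
    · exact hmin _ (by rw [norm_neg, hb]) (by rw [hJn, hJb])
end

section
/- Let a, b, c be linearly independent unit vectors in ℝ³ and let p be a unit vector that is a minimizer for (a,b,c). Then for any two distinct vectors v₁, v₂ taken from the set {a, b, c} one has d(v₁, p) ≤ d(v₁, v₂). -/
open RealInnerProductSpace

theorem norm_sub_smul_sq (x z : EuclideanSpace ℝ (Fin 3)) (hx : ‖x‖ = 1) (hz : ‖z‖ = 1) (t : ℝ) :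
    ‖x - t • z‖ ^ 2 = 1 - 2 * t * ⟪x, z⟫ + t ^ 2 := by
  rw [norm_sub_sq_real, norm_smul, inner_smul_right, hx, hz, mul_one, Real.norm_eq_abs, sq_abs]
  ring

theorem dS_le_norm (x z : EuclideanSpace ℝ (Fin 3)) (hx : ‖x‖ = 1) (hz : ‖z‖ = 1) (t : ℝ) :
    dS x z ≤ ‖x - t • z‖ := by
  unfold dS
  apply Real.sqrt_le_iff.mpr
  refine ⟨norm_nonneg _, ?_⟩
  rw [norm_sub_smul_sq x z hx hz]
  nlinarith [sq_nonneg (t - ⟪x, z⟫)]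

theorem dS_eq_norm (x z : EuclideanSpace ℝ (Fin 3)) (hx : ‖x‖ = 1) (hz : ‖z‖ = 1) :
    dS x z = ‖x - (⟪x, z⟫ : ℝ) • z‖ := by
  unfold dS
  rw [← Real.sqrt_sq (norm_nonneg (x - (⟪x, z⟫ : ℝ) • z)), norm_sub_smul_sq x z hx hz]
  congr 1
  ring

theorem dS_comm (x y : EuclideanSpace ℝ (Fin 3)) : dS x y = dS y x := by
  unfold dS
  rw [real_inner_comm]

theorem dS_self (x : EuclideanSpace ℝ (Fin 3)) (hx : ‖x‖ = 1) : dS x x = 0 := by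
  unfold dS
  rw [real_inner_self_eq_norm_sq, hx]
  norm_num

/-- Triangle inequality for the sine of the angle between lines. -/
theorem dS_triangle (x y z : EuclideanSpace ℝ (Fin 3)) (hx : ‖x‖ = 1) (hy : ‖y‖ = 1)
    (hz : ‖z‖ = 1) : dS x z ≤ dS x y + dS y z := by
  have h1 := dS_le_norm x z hx hz ((⟪x, y⟫ : ℝ) * ⟪y, z⟫)
  have h2 : x - ((⟪x, y⟫ : ℝ) * ⟪y, z⟫) • z
      = (x - (⟪x, y⟫ : ℝ) • y) + (⟪x, y⟫ : ℝ) • (y - (⟪y, z⟫ : ℝ) • z) := by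
    rw [smul_sub, smul_smul]
    abel
  have h3 : |(⟪x, y⟫ : ℝ)| ≤ 1 := by
    have := abs_real_inner_le_norm x y
    rwa [hx, hy, mul_one] at this
  rw [h2] at h1
  have h4 := norm_add_le (x - (⟪x, y⟫ : ℝ) • y) ((⟪x, y⟫ : ℝ) • (y - (⟪y, z⟫ : ℝ) • z))
  rw [norm_smul, Real.norm_eq_abs] at h4
  rw [dS_eq_norm x y hx hy, dS_eq_norm y z hy hz]
  have h5 := mul_le_mul_of_nonneg_right h3 (norm_nonneg (y - (⟪y, z⟫ : ℝ) • z))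
  linarith

theorem stmt6 (a b c p : EuclideanSpace ℝ (Fin 3))
    (ha : ‖a‖ = 1) (hb : ‖b‖ = 1) (hc : ‖c‖ = 1)
    (hli : LinearIndependent ℝ ![a, b, c])
    (hp : IsMinimizer a b c p)
    (v₁ v₂ : EuclideanSpace ℝ (Fin 3))
    (hv₁ : v₁ ∈ ({a, b, c} : Set (EuclideanSpace ℝ (Fin 3))))
    (hv₂ : v₂ ∈ ({a, b, c} : Set (EuclideanSpace ℝ (Fin 3))))
    (hne : v₁ ≠ v₂) :
    dS v₁ p ≤ dS v₁ v₂ := by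
  obtain ⟨hp1, hmin⟩ := hp
  have Ja := hmin a ha
  have Jb := hmin b hb
  have Jc := hmin c hc
  have tab := dS_triangle a p b ha hp1 hb
  have tac := dS_triangle a p c ha hp1 hc
  have tbc := dS_triangle b p c hb hp1 hc
  simp only [J, dS_self a ha, dS_self b hb, dS_self c hc] at Ja Jb Jc
  rw [dS_comm p b] at tab
  rw [dS_comm p c] at tac tbc
  rw [dS_comm b a, dS_comm c a] at Ja
  rw [dS_comm c b] at Jb
  simp only [Set.mem_insert_iff, Set.mem_singleton_iff] at hv₁ hv₂
  have hba := dS_comm b a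
  have hca := dS_comm c a
  have hcb := dS_comm c b
  rcases hv₁ with rfl | rfl | rfl <;> rcases hv₂ with rfl | rfl | rfl <;>
    first
    | exact absurd rfl hne
    | linarith
end
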